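/- Pure decay drives every entity to level 0 in bounded time: let life : ℕ → ℕ assign a finite decay duration to each positive level, and define the tick-decay step f : ℕ × ℕ → ℕ × ℕ by f(ℓ, u) = (ℓ, u) if ℓ = 0, f(ℓ, u) = (ℓ − 1, 0) if ℓ > 0 and u > life ℓ, and f(ℓ, u) = (ℓ, u + 1) otherwise. Then for every initial level ℓ₀, the iterate f^[N](ℓ₀, 0) has first component 0, where N = ∑_{i=1}^{ℓ₀} (life i + 2); moreover the first component of f^[n](ℓ₀, 0) is nonincreasing in n and level 0 is absorbing (f fixes the level of any state with level 0). -/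

import Mathlib

/-- One tick of the pure decay process: the state is a pair (level, counter);
level 0 is absorbing; at a positive level, once the counter exceeds the lifetime of
the level, the level decreases by one and the counter resets; otherwise the counter
is incremented. -/
def tickDecay (life : ℕ → ℕ) : ℕ × ℕ → ℕ × ℕ := fun p =>
  if p.1 = 0 then p
  else if p.2 > life p.1 then (p.1 - 1, 0)
  else (p.1, p.2 + 1)

theorem tickDecay_count (life : ℕ → ℕ) (l : ℕ) (k : ℕ) (hk : k ≤ life (l+1) + 1) :
    (tickDecay life)^[k] (l+1, 0) = (l+1, k) := by
  induction k with
  | zero => rfl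
  | succ k ih =>
    rw [Function.iterate_succ_apply', ih (by omega)]
    have h : ¬ (k > life (l+1)) := by omega
    simp [tickDecay]
    omega

theorem tickDecay_level (life : ℕ → ℕ) (l : ℕ) :
    (tickDecay life)^[life (l+1) + 2] (l+1, 0) = (l, 0) := by
  rw [Function.iterate_succ_apply', tickDecay_count life l _ le_rfl]
  simp [tickDecay]

theorem tickDecay_zero (life : ℕ → ℕ) (l : ℕ) :
    ((tickDecay life)^[∑ i ∈ Finset.Icc 1 l, (life i + 2)] (l, 0)).1 = 0 := by
  induction l with
  | zero => simp
  | succ l ih =>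
    rw [Finset.sum_Icc_succ_top (by omega), Function.iterate_add_apply, tickDecay_level]
    exact ih

/-- Pure decay drives every entity to level 0 in bounded time: starting at level `ℓ₀`
with counter 0, after `N = ∑_{i=1}^{ℓ₀} (life i + 2)` ticks the level is 0; moreover
the level is nonincreasing along the ticks, and level 0 is absorbing. -/
theorem decay_reaches_zero (life : ℕ → ℕ) (ℓ₀ : ℕ) :
    ((tickDecay life)^[∑ i ∈ Finset.Icc 1 ℓ₀, (life i + 2)] (ℓ₀, 0)).1 = 0 ∧
    (∀ m n : ℕ, m ≤ n →
      ((tickDecay life)^[n] (ℓ₀, 0)).1 ≤ ((tickDecay life)^[m] (ℓ₀, 0)).1) ∧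
    (∀ p : ℕ × ℕ, p.1 = 0 → tickDecay life p = p) := by
  refine ⟨tickDecay_zero life ℓ₀, ?_, ?_⟩
  · intro m n hmn
    refine antitone_nat_of_succ_le (f := fun n => ((tickDecay life)^[n] (ℓ₀, 0)).1) ?_ hmn
    intro n
    simp only [Function.iterate_succ_apply']
    generalize (tickDecay life)^[n] (ℓ₀, 0) = p
    unfold tickDecay
    split_ifs <;> simp
  · intro p hp
    simp [tickDecay, hp]
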